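/- arXiv:1804.06791 — 4 statements merged into one kernel-verified Lean document; each statement's English description precedes it below -/
import Mathlib

section
/- For all d, β, ε > 0 with ε ≤ d²/100 and every real M ≥ 1, there exist k₀ ∈ ℕ and γ > 0 such that the following holds. Let T be a tree of order k ≥ k₀ with colour classes V₁, V₂ such that every v ∈ V₂ has degree at most γk in T, and let (W, 𝒟), 𝒟 = 𝒟' ⊔ 𝒟'', be a one-sided βk-fine partition of T. Let v₁ and v₂ be two disjoint vertex sets of a graph G forming an ε-regular pair of density at least d, with |v₁| = |v₂| ≥ k/M. Let U ⊆ v₁ with |U| ≤ 2√ε·|v₁|. Then there is an injective map φ defined on W ∪ (⋃𝒟'') that maps every vertex of W into v₁ ∖ U, maps every vertex of ⋃𝒟'' into v₂, and satisfies φ(x)φ(y) ∈ E(G) for every edge xy of T with both x, y ∈ W ∪ (⋃𝒟''). -/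
open SimpleGraph Finset

/-- The number of edges of `G` between the disjoint vertex sets `X` and `Y`. -/
noncomputable def eBetween {V : Type*} (G : SimpleGraph V) (X Y : Finset V) : ℕ :=
  {p : V × V | p.1 ∈ X ∧ p.2 ∈ Y ∧ G.Adj p.1 p.2}.ncard

/-- The edge density `d(X,Y) = e(X,Y)/(|X||Y|)` between disjoint vertex sets. -/
noncomputable def density {V : Type*} (G : SimpleGraph V) (X Y : Finset V) : ℝ :=
  (eBetween G X Y : ℝ) / ((X.card : ℝ) * (Y.card : ℝ))

/-- `(X,Y)` is an `ε`-regular pair: all subsets `X' ⊆ X`, `Y' ⊆ Y` with `|X'| ≥ ε|X|`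
and `|Y'| ≥ ε|Y|` satisfy `|d(X',Y') − d(X,Y)| ≤ ε`. -/
def IsRegularPair {V : Type*} (G : SimpleGraph V) (ε : ℝ) (X Y : Finset V) : Prop :=
  ∀ X' ⊆ X, ∀ Y' ⊆ Y, ε * (X.card : ℝ) ≤ (X'.card : ℝ) →
    ε * (Y.card : ℝ) ≤ (Y'.card : ℝ) →
    |density G X' Y' - density G X Y| ≤ ε

/-- A one-sided `ℓ`-fine partition (with real parameter `ℓ`) of a tree `T` of order `k`
with colour classes `V₁, V₂`, where `Δ` is the maximum degree in `T` over `V₂`, given with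
its splitting `𝒟 = D' ⊔ D''`: `W ⊆ V₁`; the members of `D' ∪ D''` are subtrees of `T`
whose vertex sets together with `W` partition `V(T)`; `|W| ≤ 336(k−1)(1+Δ)/ℓ`; every
subtree has at most `ℓ` vertices; the outside neighbourhood of every subtree lies in `W`;
every tree of `D'` has at most two neighbours in `W`, at distance at least `4` in `T` if
there are two; `|D''| ≤ 336(k−1)/ℓ` and every tree of `D''` is a single vertex with at
most `Δ` neighbours in `W`. -/
def IsOneSidedFinePartitionR (k : ℕ) (T : SimpleGraph (Fin k))
    (V₁ V₂ : Finset (Fin k)) (ℓ : ℝ)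
    (W : Finset (Fin k)) (D' D'' : Finset (Finset (Fin k))) : Prop :=
  let Δ : ℕ := V₂.sup fun v => (T.neighborSet v).ncard
  W ⊆ V₁ ∧
  Disjoint D' D'' ∧
  (∀ K ∈ D' ∪ D'', K.Nonempty ∧ (T.induce (K : Set (Fin k))).Connected) ∧
  (∀ K ∈ D' ∪ D'', Disjoint K W) ∧
  (∀ K ∈ D' ∪ D'', ∀ L ∈ D' ∪ D'', K ≠ L → Disjoint K L) ∧
  W ∪ (D' ∪ D'').biUnion id = Finset.univ ∧
  (W.card : ℝ) ≤ 336 * ((k : ℝ) - 1) * (1 + (Δ : ℝ)) / ℓ ∧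
  (∀ K ∈ D' ∪ D'', (K.card : ℝ) ≤ ℓ) ∧
  (∀ K ∈ D' ∪ D'', ∀ v, v ∉ K → (∃ u ∈ K, T.Adj u v) → v ∈ W) ∧
  (∀ K ∈ D', {z | z ∈ W ∧ ∃ u ∈ K, T.Adj u z}.ncard ≤ 2 ∧
    ∀ z₁ ∈ W, ∀ z₂ ∈ W, (∃ u ∈ K, T.Adj u z₁) → (∃ u ∈ K, T.Adj u z₂) →
      z₁ ≠ z₂ → 4 ≤ T.dist z₁ z₂) ∧
  (D''.card : ℝ) ≤ 336 * ((k : ℝ) - 1) / ℓ ∧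
  (∀ K ∈ D'', ∃ x, K = {x} ∧ {z | z ∈ W ∧ T.Adj x z}.ncard ≤ Δ)

/-- In a tree, a vertex has at most one neighbour that is no further from a given root. -/
theorem SimpleGraph.IsTree.eq_of_adj_of_dist_le {V : Type*} {T : SimpleGraph V} (hT : T.IsTree)
    (r : V) {x y z : V} (hy : T.Adj x y) (hz : T.Adj x z) (hyd : T.dist r y ≤ T.dist r x)
    (hzd : T.dist r z ≤ T.dist r x) : y = z := by
  obtain ⟨p, hp, hpl⟩ := hT.connected.exists_path_of_dist r x
  have key : ∀ w, T.Adj x w → T.dist r w ≤ T.dist r x → w = p.penultimate := by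
    intro w hw hwd
    refine hT.isAcyclic.eq_penultimate_of_adj_end hp hw ?_
    by_contra hmem
    obtain ⟨q, hq, hql⟩ := hT.connected.exists_path_of_dist r w
    have := congrArg Walk.length (Subtype.mk.inj <|
      (hT.isAcyclic.subsingleton_path r w).elim ⟨q, hq⟩ ⟨_, hp.concat hmem hw⟩)
    rw [Walk.length_concat] at this
    omega
  rw [key y hy hyd, key z hz hzd]

/-- Greedy embedding: a set `S` of vertices of a tree can be embedded into `G` with each `x`
mapped into a prescribed set `P x`, as soon as all relevant degrees are at least `|S|`. -/
theorem SimpleGraph.IsTree.exists_greedy_embedding {V α : Type*} [Nonempty α] {T : SimpleGraph V}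
    (hT : T.IsTree) (G : SimpleGraph α) [DecidableRel G.Adj] (P : V → Finset α)
    (S : Finset V) (hP : ∀ x ∈ S, #S ≤ #(P x))
    (hdeg : ∀ x ∈ S, ∀ y ∈ S, T.Adj x y → ∀ a ∈ P x, #S ≤ #{b ∈ P y | G.Adj a b}) :
    ∃ φ : V → α, Set.InjOn φ S ∧ (∀ x ∈ S, φ x ∈ P x) ∧
      ∀ x ∈ S, ∀ y ∈ S, T.Adj x y → G.Adj (φ x) (φ y) := by
  classical
  obtain ⟨r⟩ := hT.connected.nonempty
  induction hn : #S generalizing S with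
  | zero =>
    obtain rfl := Finset.card_eq_zero.1 hn
    exact ⟨fun _ => Classical.arbitrary α, by simp⟩
  | succ n ih =>
    have hne : S.Nonempty := Finset.card_pos.1 (by omega)
    obtain ⟨x, hxS, hx⟩ := S.exists_max_image (T.dist r) hne
    have hcard : #(S.erase x) = n := by rw [Finset.card_erase_of_mem hxS]; omega
    obtain ⟨φ, hinj, hmem, hadj⟩ := ih (S.erase x)
      (fun y hy => by have := hP y (Finset.mem_of_mem_erase hy); omega)
      (fun y hy z hz h a ha => by
        have := hdeg y (Finset.mem_of_mem_erase hy) z (Finset.mem_of_mem_erase hz) h a ha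
        omega) hcard
    have himg : #((S.erase x).image φ) ≤ n := hcard ▸ Finset.card_image_le
    obtain ⟨b, hbP, hbφ, hb⟩ : ∃ b ∈ P x, b ∉ (S.erase x).image φ ∧
        ∀ y ∈ S, T.Adj x y → G.Adj (φ y) b := by
      by_cases h : ∃ y ∈ S, T.Adj x y
      · obtain ⟨y, hyS, hxy⟩ := h
        have hyE : y ∈ S.erase x := Finset.mem_erase.2 ⟨hxy.ne', hyS⟩
        have hd := hdeg y hyS x hxS hxy.symm (φ y) (hmem y hyE)
        obtain ⟨b, hb, hb'⟩ := Finset.exists_mem_notMem_of_card_lt_card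
          (s := (S.erase x).image φ) (t := {b ∈ P x | G.Adj (φ y) b}) (by omega)
        rw [Finset.mem_filter] at hb
        refine ⟨b, hb.1, hb', fun z hzS hxz => ?_⟩
        rw [hT.eq_of_adj_of_dist_le r hxz hxy (hx z hzS) (hx y hyS)]
        exact hb.2
      · obtain ⟨b, hb, hb'⟩ := Finset.exists_mem_notMem_of_card_lt_card
          (s := (S.erase x).image φ) (t := P x) (by have := hP x hxS; omega)
        exact ⟨b, hb, hb', fun y hyS hxy => absurd ⟨y, hyS, hxy⟩ h⟩
    have hne' : ∀ y ∈ S, y ≠ x → y ∈ S.erase x := fun y hy h => Finset.mem_erase.2 ⟨h, hy⟩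
    have hbne : ∀ y ∈ S, y ≠ x → φ y ≠ b := fun y hy h hyb =>
      hbφ (Finset.mem_image.2 ⟨y, hne' y hy h, hyb⟩)
    refine ⟨Function.update φ x b, ?_, ?_, ?_⟩
    · intro y hy z hz hyz
      by_cases h₁ : y = x <;> by_cases h₂ : z = x
      · rw [h₁, h₂]
      · subst h₁
        rw [Function.update_self, Function.update_of_ne h₂] at hyz
        exact absurd hyz.symm (hbne z hz h₂)
      · subst h₂
        rw [Function.update_self, Function.update_of_ne h₁] at hyz
        exact absurd hyz (hbne y hy h₁)
      · rw [Function.update_of_ne h₁, Function.update_of_ne h₂] at hyz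
        exact hinj (hne' y hy h₁) (hne' z hz h₂) hyz
    · intro y hy
      by_cases h : y = x
      · subst h; rwa [Function.update_self]
      · rw [Function.update_of_ne h]; exact hmem y (hne' y hy h)
    · intro y hy z hz hyz
      by_cases h₁ : y = x
      · subst h₁
        rw [Function.update_self, Function.update_of_ne hyz.ne']
        exact (hb z hz hyz).symm
      · by_cases h₂ : z = x
        · subst h₂
          rw [Function.update_self, Function.update_of_ne h₁]
          exact hb y hy hyz.symm
        · rw [Function.update_of_ne h₁, Function.update_of_ne h₂]
          exact hadj y (hne' y hy h₁) z (hne' z hz h₂) hyz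

/-- A pair of vertex sets with more than `δ(|A| + |B|)` edges contains a nonempty pair of
subsets with minimum degree at least `δ`. -/
theorem SimpleGraph.exists_subpair_le_degree {α : Type*} (G : SimpleGraph α)
    [DecidableRel G.Adj] (A B : Finset α) {δ : ℝ} (hδ : 0 ≤ δ)
    (h : δ * (#A + #B) < #(G.interedges A B)) :
    ∃ X ⊆ A, ∃ Y ⊆ B, X.Nonempty ∧ Y.Nonempty ∧
      (∀ x ∈ X, δ ≤ #{y ∈ Y | G.Adj x y}) ∧ ∀ y ∈ Y, δ ≤ #{x ∈ X | G.Adj y x} := by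
  classical
  induction hn : #A + #B generalizing A B with
  | zero =>
    obtain rfl : A = ∅ := Finset.card_eq_zero.1 (by omega)
    obtain rfl : B = ∅ := Finset.card_eq_zero.1 (by omega)
    simp at h
  | succ n ih =>
    by_cases hA : ∃ x ∈ A, (#{y ∈ B | G.Adj x y} : ℝ) < δ
    · obtain ⟨x, hx, hxδ⟩ := hA
      have hc : #(A.erase x) + 1 = #A := Finset.card_erase_add_one hx
      have he : #(G.interedges A B) ≤ #(G.interedges (A.erase x) B) + #{y ∈ B | G.Adj x y} := by
        calc #(G.interedges A B)
            ≤ #(G.interedges (A.erase x) B ∪ {y ∈ B | G.Adj x y}.image (x, ·)) := by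
              refine Finset.card_le_card fun ⟨a, b⟩ hab => ?_
              rw [mk_mem_interedges_iff] at hab
              by_cases hax : a = x
              · subst hax; simp [hab]
              · simp [mk_mem_interedges_iff, hab, hax]
          _ ≤ _ := (Finset.card_union_le _ _).trans (by gcongr; exact Finset.card_image_le)
      have he' : (#(G.interedges A B) : ℝ) ≤
        #(G.interedges (A.erase x) B) + #{y ∈ B | G.Adj x y} := by exact_mod_cast he
      have hc' : (#(A.erase x) : ℝ) + 1 = #A := by exact_mod_cast hc
      obtain ⟨X, hX, Y, hY, hrest⟩ := ih (A.erase x) B (by rw [← hc'] at h; linarith) (by omega)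
      exact ⟨X, hX.trans (Finset.erase_subset _ _), Y, hY, hrest⟩
    by_cases hB : ∃ y ∈ B, (#{x ∈ A | G.Adj y x} : ℝ) < δ
    · obtain ⟨y, hy, hyδ⟩ := hB
      have hc : #(B.erase y) + 1 = #B := Finset.card_erase_add_one hy
      have he : #(G.interedges A B) ≤ #(G.interedges A (B.erase y)) + #{x ∈ A | G.Adj y x} := by
        calc #(G.interedges A B)
            ≤ #(G.interedges A (B.erase y) ∪ {x ∈ A | G.Adj y x}.image (·, y)) := by
              refine Finset.card_le_card fun ⟨a, b⟩ hab => ?_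
              rw [mk_mem_interedges_iff] at hab
              by_cases hby : b = y
              · subst hby; simp [hab, G.adj_comm b]
              · simp [mk_mem_interedges_iff, hab, hby]
          _ ≤ _ := (Finset.card_union_le _ _).trans (by gcongr; exact Finset.card_image_le)
      have he' : (#(G.interedges A B) : ℝ) ≤
        #(G.interedges A (B.erase y)) + #{x ∈ A | G.Adj y x} := by exact_mod_cast he
      have hc' : (#(B.erase y) : ℝ) + 1 = #B := by exact_mod_cast hc
      obtain ⟨X, hX, Y, hY, hrest⟩ := ih A (B.erase y) (by rw [← hc'] at h; linarith) (by omega)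
      exact ⟨X, hX, Y, hY.trans (Finset.erase_subset _ _), hrest⟩
    push Not at hA hB
    have hpos : 0 < #(G.interedges A B) := by
      have : (0 : ℝ) ≤ δ * (#A + #B) := by positivity
      exact_mod_cast this.trans_lt h
    obtain ⟨⟨a, b⟩, hab⟩ := Finset.card_pos.1 hpos
    rw [mk_mem_interedges_iff] at hab
    exact ⟨A, subset_rfl, B, subset_rfl, ⟨a, hab.1⟩, ⟨b, hab.2.1⟩, hA, hB⟩

/-- Each vertex removed from one side of a pair destroys at most `|Y|` edges. -/
theorem SimpleGraph.card_interedges_le_sdiff_add {α : Type*} [DecidableEq α] (G : SimpleGraph α)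
    [DecidableRel G.Adj] (X U Y : Finset α) :
    #(G.interedges X Y) ≤ #(G.interedges (X \ U) Y) + #U * #Y := by
  calc #(G.interedges X Y) ≤ #(G.interedges (X \ U) Y ∪ U ×ˢ Y) := by
        refine Finset.card_le_card fun ⟨a, b⟩ hab => ?_
        rw [mk_mem_interedges_iff] at hab
        by_cases ha : a ∈ U <;> simp [mk_mem_interedges_iff, hab, ha]
    _ ≤ _ := (Finset.card_union_le _ _).trans (by rw [Finset.card_product])

theorem eBetween_eq_card_interedges {α : Type*} (G : SimpleGraph α) [DecidableRel G.Adj]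
    (X Y : Finset α) : eBetween G X Y = #(G.interedges X Y) := by
  rw [eBetween, ← Set.ncard_coe_finset]
  congr 1
  ext p
  simp [SimpleGraph.mem_interedges_iff]

/-- A set `W` together with the union of a family `D` of singletons has at most `|W| + |D|`
elements. -/
theorem card_union_biUnion_le {V : Type*} [DecidableEq V] (W : Finset V) (D : Finset (Finset V))
    (hD : ∀ K ∈ D, ∃ x, K = {x}) : #(W ∪ D.biUnion id) ≤ #W + #D := by
  refine (Finset.card_union_le _ _).trans (Nat.add_le_add_left ?_ _)
  refine (Finset.card_biUnion_le_card_mul D id 1 fun K hK => ?_).trans (by simp)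
  obtain ⟨x, rfl⟩ := hD K hK
  simp

/-- For all `d, β, ε > 0` with `ε ≤ d²/100` and every `M ≥ 1` there are `k₀` and `γ > 0`
such that: for every tree `T` of order `k ≥ k₀` whose colour class `V₂` has maximum degree
at most `γk`, every one-sided `βk`-fine partition `(W, D' ⊔ D'')` of `T`, every `ε`-regular
pair `(v₁, v₂)` of density at least `d` with `|v₁| = |v₂| ≥ k/M` in a graph `G`, and every
`U ⊆ v₁` with `|U| ≤ 2√ε·|v₁|`, there is an injective mapping `φ` of `W ∪ ⋃D''` embedding
`W` into `v₁ ∖ U` and `⋃D''` into `v₂` and preserving the edges of `T` inside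
`W ∪ ⋃D''`. -/
theorem embed_seeds (d β ε : ℝ) (hd : 0 < d) (hβ : 0 < β) (hε : 0 < ε)
    (hεd : ε ≤ d ^ 2 / 100) (M : ℝ) (hM : 1 ≤ M) :
    ∃ (k₀ : ℕ) (γ : ℝ), 0 < γ ∧
      ∀ (k : ℕ), k₀ ≤ k →
      ∀ (T : SimpleGraph (Fin k)) (V₁ V₂ : Finset (Fin k)),
        T.IsTree →
        (∀ v, v ∈ V₁ ∨ v ∈ V₂) → Disjoint V₁ V₂ →
        (∀ ⦃x y⦄, T.Adj x y → ((x ∈ V₁ ∧ y ∈ V₂) ∨ (x ∈ V₂ ∧ y ∈ V₁))) →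
        (∀ v ∈ V₂, ((T.neighborSet v).ncard : ℝ) ≤ γ * k) →
      ∀ (W : Finset (Fin k)) (D' D'' : Finset (Finset (Fin k))),
        IsOneSidedFinePartitionR k T V₁ V₂ (β * k) W D' D'' →
      ∀ (α : Type) [DecidableEq α] (G : SimpleGraph α) (v₁ v₂ : Finset α),
        Disjoint v₁ v₂ →
        IsRegularPair G ε v₁ v₂ →
        d ≤ density G v₁ v₂ →
        v₁.card = v₂.card →
        (k : ℝ) / M ≤ (v₁.card : ℝ) →
      ∀ U ⊆ v₁, (U.card : ℝ) ≤ 2 * Real.sqrt ε * (v₁.card : ℝ) →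
        ∃ φ : Fin k → α,
          Set.InjOn φ ↑(W ∪ D''.biUnion id) ∧
          (∀ x ∈ W, φ x ∈ v₁ \ U) ∧
          (∀ x ∈ D''.biUnion id, φ x ∈ v₂) ∧
          (∀ x ∈ W ∪ D''.biUnion id, ∀ y ∈ W ∪ D''.biUnion id,
            T.Adj x y → G.Adj (φ x) (φ y)) := by
  classical
  have hM0 : 0 < M := by linarith
  refine ⟨max 2 ⌈672 * (8 * M) / (d * β)⌉₊, d * β / (336 * (8 * M)), by positivity, ?_⟩
  intro k hk T V₁ V₂ hT hcov hdisj hbip hdeg W D' D'' hpart α _ G v₁ v₂ _ _ hdens hcard hkM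
    U hU hUcard
  obtain ⟨hWV, -, -, hKW, -, -, hWc, -, hN, -, hDc, hsing⟩ := hpart
  have hk2 : 2 ≤ k := (le_max_left _ _).trans hk
  have hkR : (0 : ℝ) < k := by exact_mod_cast (by omega : 0 < k)
  have hkbig : 672 * (8 * M) / (d * β) ≤ k :=
    (Nat.le_ceil _).trans (by exact_mod_cast (le_max_right _ _).trans hk)
  have : Nontrivial (Fin k) := Fin.nontrivial_iff_two_le.2 hk2
  set n : ℝ := (#v₁ : ℝ) with hn
  have hn0 : 0 < n := lt_of_lt_of_le (by positivity) hkM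
  have hDV : ∀ x ∈ D''.biUnion id, x ∈ V₂ ∧ x ∉ W := by
    intro x hx
    obtain ⟨K, hK, hxK⟩ := Finset.mem_biUnion.1 hx
    have hKu : K ∈ D' ∪ D'' := Finset.mem_union_right _ hK
    refine ⟨?_, Finset.disjoint_left.1 (hKW K hKu) hxK⟩
    refine (hcov x).resolve_left fun hx₁ => ?_
    obtain ⟨y, hxy⟩ := hT.connected.preconnected.exists_adj_of_nontrivial x
    obtain ⟨z, rfl, -⟩ := hsing K hK
    obtain rfl : x = z := Finset.mem_singleton.1 hxK
    have hyW : y ∈ W := hN _ hKu y (by simpa using hxy.ne') ⟨x, hxK, hxy⟩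
    rcases hbip hxy with ⟨-, h⟩ | ⟨h, -⟩
    · exact Finset.disjoint_left.1 hdisj (hWV hyW) h
    · exact Finset.disjoint_left.1 hdisj hx₁ h
  set δ : ℝ := d * n / 4 with hδ
  have hS : (#(W ∪ D''.biUnion id) : ℝ) ≤ δ := by
    have h₁ : (#(W ∪ D''.biUnion id) : ℝ) ≤ #W + #D'' := by
      exact_mod_cast card_union_biUnion_le W D'' fun K hK =>
        (hsing K hK).imp fun _ h => h.1
    have hΔ : ((V₂.sup fun v => (T.neighborSet v).ncard : ℕ) : ℝ) ≤
        d * β / (336 * (8 * M)) * k := by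
      rcases V₂.eq_empty_or_nonempty with rfl | hne
      · simp; positivity
      · obtain ⟨v, hv, hveq⟩ := Finset.exists_mem_eq_sup V₂ hne
          (fun v => (T.neighborSet v).ncard)
        rw [hveq]
        exact hdeg v hv
    set Δ : ℝ := ((V₂.sup fun v => (T.neighborSet v).ncard : ℕ) : ℝ)
    have hΔ0 : 0 ≤ Δ := by positivity
    have hW₁ : (#W : ℝ) ≤ 336 * (1 + Δ) / β := by
      refine hWc.trans ?_
      rw [div_le_div_iff₀ (by positivity) hβ]
      have : 0 ≤ 336 * (1 + Δ) * β := by positivity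
      nlinarith
    have hD₁ : (#D'' : ℝ) ≤ 336 / β := by
      refine hDc.trans ?_
      rw [div_le_div_iff₀ (by positivity) hβ]
      nlinarith
    have hΔ₁ : 336 * Δ / β ≤ d / 8 * (k / M) := by
      calc 336 * Δ / β ≤ 336 * (d * β / (336 * (8 * M)) * k) / β := by gcongr
        _ = d / 8 * (k / M) := by field_simp
    have hc : 672 / β ≤ d / 8 * (k / M) := by
      calc 672 / β = d / 8 * (672 * (8 * M) / (d * β) / M) := by field_simp
        _ ≤ d / 8 * (k / M) := by gcongr
    have hdn : d / 4 * (k / M) ≤ d / 4 * n := by gcongr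
    have hsplit : 336 * (1 + Δ) / β + 336 / β = 672 / β + 336 * Δ / β := by ring
    rw [hδ]
    linarith
  have hε10 : Real.sqrt ε ≤ d / 10 := by
    refine Real.sqrt_le_iff.2 ⟨by positivity, by linarith [hεd, div_pow d 10 2]⟩
  have hedges : d * n ^ 2 ≤ #(G.interedges v₁ v₂) := by
    rw [density, eBetween_eq_card_interedges, ← hcard, ← hn, le_div_iff₀ (by positivity)] at hdens
    linarith
  have hrem : (#(G.interedges v₁ v₂) : ℝ) ≤ #(G.interedges (v₁ \ U) v₂) + #U * n := by
    have := G.card_interedges_le_sdiff_add v₁ U v₂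
    rw [← hcard] at this
    rw [hn]
    exact_mod_cast this
  have hUn : (#U : ℝ) ≤ d / 5 * n := hUcard.trans (by gcongr; linarith)
  have hcA : (#(v₁ \ U) : ℝ) ≤ n := by
    rw [hn]
    exact_mod_cast Finset.card_le_card Finset.sdiff_subset
  have hmain : δ * (#(v₁ \ U) + #v₂) < #(G.interedges (v₁ \ U) v₂) := by
    rw [← hcard, ← hn]
    have h₁ : δ * (#(v₁ \ U) + n) ≤ δ * (n + n) := by gcongr
    have h₂ : (#U : ℝ) * n ≤ d / 5 * n * n := by gcongr
    have h₃ : 0 < d * n ^ 2 := by positivity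
    rw [hδ] at h₁ ⊢
    nlinarith
  obtain ⟨X, hX, Y, hY, ⟨a, ha⟩, ⟨b, hb⟩, hXd, hYd⟩ :=
    G.exists_subpair_le_degree (v₁ \ U) v₂ (by positivity) hmain
  have : Nonempty α := ⟨a⟩
  have hsize : ∀ x ∈ W ∪ D''.biUnion id,
      #(W ∪ D''.biUnion id) ≤ #(if x ∈ W then X else Y) := by
    intro x _
    have hXc : #(W ∪ D''.biUnion id) ≤ #X := by
      have := (hS.trans (hYd b hb)).trans (Nat.cast_le.2 (Finset.card_filter_le _ _))
      exact_mod_cast this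
    have hYc : #(W ∪ D''.biUnion id) ≤ #Y := by
      have := (hS.trans (hXd a ha)).trans (Nat.cast_le.2 (Finset.card_filter_le _ _))
      exact_mod_cast this
    split_ifs <;> assumption
  have hdegree : ∀ x ∈ W ∪ D''.biUnion id, ∀ y ∈ W ∪ D''.biUnion id, T.Adj x y →
      ∀ a ∈ (if x ∈ W then X else Y),
        #(W ∪ D''.biUnion id) ≤ #{b ∈ (if y ∈ W then X else Y) | G.Adj a b} := by
    intro x hx y hy hxy c hc
    have hV : ∀ z ∈ W ∪ D''.biUnion id, z ∉ W → z ∈ V₂ := fun z hz hzW =>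
      (hDV z ((Finset.mem_union.1 hz).resolve_left hzW)).1
    have hd₁ := Finset.disjoint_left.1 hdisj
    by_cases hxW : x ∈ W <;> by_cases hyW : y ∈ W
    · rcases hbip hxy with ⟨-, h⟩ | ⟨h, -⟩
      · exact absurd h (hd₁ (hWV hyW))
      · exact absurd h (hd₁ (hWV hxW))
    · simp only [hxW, hyW, if_true, if_false] at hc ⊢
      exact_mod_cast hS.trans (hXd c hc)
    · simp only [hxW, hyW, if_true, if_false] at hc ⊢
      exact_mod_cast hS.trans (hYd c hc)
    · rcases hbip hxy with ⟨h, -⟩ | ⟨-, h⟩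
      · exact absurd (hV x hx hxW) (hd₁ h)
      · exact absurd (hV y hy hyW) (hd₁ h)
  obtain ⟨φ, hinj, hmem, hadj⟩ := hT.exists_greedy_embedding G (fun x => if x ∈ W then X else Y)
    (W ∪ D''.biUnion id) hsize hdegree
  refine ⟨φ, hinj, fun x hx => ?_, fun x hx => ?_, hadj⟩
  · have := hmem x (Finset.mem_union_left _ hx)
    rw [if_pos hx] at this
    exact hX this
  · have := hmem x (Finset.mem_union_right _ hx)
    rw [if_neg (hDV x hx).2] at this
    exact hY this
end

section
/- For all d, ε with 0 < d, ε ≤ 1 and ε < d²/100, and every real M ≥ 1, there exists β > 0 such that the following holds. Let v₁, u, v be three pairwise disjoint vertex sets of a graph G such that (v₁, u) and (u, v) are ε-regular pairs of density at least d, with |v₁| = |u| = |v| ≥ k/M. Let v₁*, v₂* be two (not necessarily distinct) vertices of v₁. Let K be a tree of order at most βk and let x₁, x₂ be two (not necessarily distinct) vertices of K lying in the same colour class of K, with v₁* ≠ v₂* if and only if x₁ ≠ x₂. Let U ⊆ u ∪ v with |u ∖ U| ≥ 4√ε·|u| and |v ∖ U| ≥ 4√ε·|v|, and suppose |N_G(vᵢ*)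 ∩ (u ∖ U)| ≥ 3ε|u| for i = 1, 2. Then there is an injective map φ: V(K) → (u ∪ v) ∖ U with φ(x)φ(y) ∈ E(G) for every edge xy of K, such that φ(x₁) ∈ u is adjacent to v₁* and φ(x₂) ∈ u is adjacent to v₂*. -/
open SimpleGraph Finset

open Classical in
theorem eBetween_eq_sum {V : Type*} (G : SimpleGraph V) (X Y : Finset V) :
    eBetween G X Y = ∑ x ∈ X, (Y.filter (G.Adj x)).card := by
  have h : {p : V × V | p.1 ∈ X ∧ p.2 ∈ Y ∧ G.Adj p.1 p.2} =
      ((X ×ˢ Y).filter fun p => G.Adj p.1 p.2 : Finset (V × V)) := by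
    ext p
    simp [and_assoc]
  rw [eBetween, h, Set.ncard_coe_finset, Finset.card_filter, Finset.sum_product]
  simp only [Finset.card_filter]

theorem eBetween_comm {V : Type*} (G : SimpleGraph V) (X Y : Finset V) :
    eBetween G X Y = eBetween G Y X := by
  rw [eBetween, eBetween, ← Set.ncard_image_of_injective _ (Prod.swap_injective (α := V) (β := V))]
  congr 1
  ext ⟨a, b⟩
  simp only [Set.image_swap_eq_preimage_swap, Set.mem_preimage, Set.mem_ofPred_eq, Prod.swap_prod_mk,
    G.adj_comm b a]
  tauto

theorem density_comm {V : Type*} (G : SimpleGraph V) (X Y : Finset V) :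
    density G X Y = density G Y X := by
  rw [density, density, eBetween_comm, mul_comm (X.card : ℝ)]

theorem IsRegularPair.symm {V : Type*} {G : SimpleGraph V} {ε : ℝ} {X Y : Finset V}
    (h : IsRegularPair G ε X Y) : IsRegularPair G ε Y X := by
  intro Y' hY' X' hX' hY hX
  rw [density_comm G Y' X', density_comm G Y X]
  exact h X' hX' Y' hY' hX hY

open Classical in
/-- In a regular pair of density at least `d`, few vertices of one side have fewer than
`(d - ε)|Y'|` neighbours in a large subset `Y'` of the other side. -/
theorem IsRegularPair.card_filter_degree_lt {V : Type*} {G : SimpleGraph V} {ε d : ℝ}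
    {X Y X₀ Y' : Finset V} (h : IsRegularPair G ε X Y) (hd : d ≤ density G X Y) (hε : 0 < ε)
    (hX : 0 < X.card) (hY : 0 < Y.card) (hX₀ : X₀ ⊆ X) (hY' : Y' ⊆ Y)
    (hcard : ε * (Y.card : ℝ) ≤ (Y'.card : ℝ)) :
    ((X₀.filter fun x => ((Y'.filter (G.Adj x)).card : ℝ) < (d - ε) * Y'.card).card : ℝ) <
      ε * X.card := by
  by_contra! hlt
  set B := X₀.filter fun x => ((Y'.filter (G.Adj x)).card : ℝ) < (d - ε) * Y'.card with hB
  have hXr : (0 : ℝ) < X.card := by exact_mod_cast hX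
  have hYr : (0 : ℝ) < Y.card := by exact_mod_cast hY
  have hBpos : (0 : ℝ) < B.card := lt_of_lt_of_le (mul_pos hε hXr) hlt
  have hY'pos : (0 : ℝ) < Y'.card := lt_of_lt_of_le (mul_pos hε hYr) hcard
  have hreg := h B ((Finset.filter_subset _ _).trans hX₀) Y' hY' hlt hcard
  have hsum : (eBetween G B Y' : ℝ) < (d - ε) * (B.card * Y'.card) := by
    rw [eBetween_eq_sum]
    push_cast
    calc ∑ x ∈ B, ((Y'.filter (G.Adj x)).card : ℝ)
        < ∑ _x ∈ B, (d - ε) * Y'.card := by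
          refine Finset.sum_lt_sum_of_nonempty ?_ fun x hx => (Finset.mem_filter.1 hx).2
          exact Finset.card_pos.1 (by exact_mod_cast hBpos)
      _ = (d - ε) * (B.card * Y'.card) := by
          rw [Finset.sum_const, nsmul_eq_mul]
          ring
  have hdens : density G B Y' < d - ε := by
    rw [density, div_lt_iff₀ (mul_pos hBpos hY'pos)]
    exact hsum
  have := (abs_le.1 hreg).1
  linarith

/-- In an acyclic graph, a vertex outside a set all of whose points are joined to `r` by walks
inside the set has at most one neighbour in that set. -/
theorem SimpleGraph.IsAcyclic.eq_of_adj_of_walks {V : Type*} {K : SimpleGraph V}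
    (hK : K.IsAcyclic) {s : Finset V} {r a a' b : V}
    (hs : ∀ x ∈ s, ∃ p : K.Walk r x, ∀ y ∈ p.support, y ∈ s)
    (ha : a ∈ s) (ha' : a' ∈ s) (hb : b ∉ s) (hab : K.Adj a b) (hab' : K.Adj a' b) : a = a' := by
  classical
  by_contra hne
  obtain ⟨p, hp⟩ := hs a ha
  obtain ⟨p', hp'⟩ := hs a' ha'
  let q : K.Path a a' := (p.reverse.append p').toPath
  let q' : K.Path a a' := ⟨Walk.cons hab (Walk.cons hab'.symm Walk.nil), by
    simp [Walk.isPath_def, hab.ne, hab'.ne.symm, hne]⟩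
  have hbq : b ∈ (q : K.Walk a a').support := by
    rw [(hK.subsingleton_path a a').elim q q']
    simp [q']
  have := Walk.support_toPath_subset_support _ hbq
  rw [Walk.mem_support_append_iff, Walk.support_reverse, List.mem_reverse] at this
  exact hb (this.elim (hp b) (hp' b))

open Classical in
/-- Greedy embedding of a tree rooted at `r`, where each vertex `x` has a prescribed set `T x` of
allowed images. -/
theorem SimpleGraph.IsTree.exists_greedy_embedding_s11 {V α : Type*} [Fintype V]
    {K : SimpleGraph V} (hK : K.IsTree) (G : SimpleGraph α) (r : V) (T : V → Finset α)
    (hr : (T r).Nonempty)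
    (hT : ∀ ⦃a b⦄, K.Adj a b → b ≠ r → ∀ w ∈ T a,
      Fintype.card V ≤ ((T b).filter (G.Adj w)).card) :
    ∃ φ : V → α, Function.Injective φ ∧ (∀ x, φ x ∈ T x) ∧
      ∀ ⦃a b⦄, K.Adj a b → G.Adj (φ a) (φ b) := by
  have key : ∀ m : ℕ, m + 1 ≤ Fintype.card V → ∃ (s : Finset V) (φ : V → α), s.card = m + 1 ∧
      r ∈ s ∧ (∀ x ∈ s, ∃ p : K.Walk r x, ∀ y ∈ p.support, y ∈ s) ∧ Set.InjOn φ s ∧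
      (∀ x ∈ s, φ x ∈ T x) ∧ ∀ a ∈ s, ∀ b ∈ s, K.Adj a b → G.Adj (φ a) (φ b) := by
    intro m
    induction m with
    | zero =>
      intro _
      obtain ⟨w, hw⟩ := hr
      refine ⟨{r}, fun _ => w, by simp, by simp, ?_, by simp, by simpa using hw, by simp⟩
      intro x hx
      obtain rfl := Finset.mem_singleton.1 hx
      exact ⟨Walk.nil, by simp⟩
    | succ m ih =>
      intro hm
      obtain ⟨s, φ, hcard, hrs, hwalk, hinj, hmem, hadj⟩ := ih (by omega)
      obtain ⟨c, hc⟩ : ∃ c, c ∉ s := by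
        by_contra! hall
        have : s = Finset.univ := Finset.eq_univ_iff_forall.2 hall
        rw [this, Finset.card_univ] at hcard
        omega
      obtain ⟨p⟩ := hK.connected.preconnected r c
      obtain ⟨e, -, has, hbs⟩ := p.exists_boundary_dart (s : Set V) (by simpa using hrs)
        (by simpa using hc)
      obtain ⟨⟨a, b⟩, hab⟩ := e
      simp only [Finset.mem_coe] at has hbs
      change K.Adj a b at hab
      have huniq : ∀ a' ∈ s, K.Adj a' b → a' = a := fun a' ha' h =>
        hK.isAcyclic.eq_of_adj_of_walks hwalk ha' has hbs h hab
      obtain ⟨w, hw, hws⟩ : ∃ w ∈ (T b).filter (G.Adj (φ a)), w ∉ s.image φ := by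
        refine Finset.exists_mem_notMem_of_card_lt_card ?_
        have h₁ := hT hab (fun h => hbs (h ▸ hrs)) (φ a) (hmem a has)
        have h₂ : (s.image φ).card ≤ s.card := Finset.card_image_le
        omega
      obtain ⟨hwT, hwa⟩ := Finset.mem_filter.1 hw
      have hne : ∀ x ∈ s, x ≠ b := fun x hx h => hbs (h ▸ hx)
      have hupd : ∀ x ∈ s, Function.update φ b w x = φ x := fun x hx =>
        Function.update_of_ne (hne x hx) _ _
      refine ⟨insert b s, Function.update φ b w, by rw [Finset.card_insert_of_notMem hbs, hcard],
        Finset.mem_insert_of_mem hrs, ?_, ?_, ?_, ?_⟩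
      · intro x hx
        rcases Finset.mem_insert.1 hx with rfl | hx
        · obtain ⟨q, hq⟩ := hwalk a has
          refine ⟨q.concat hab, fun y hy => ?_⟩
          rw [Walk.support_concat, List.mem_append, List.mem_singleton] at hy
          rcases hy with hy | rfl
          · exact Finset.mem_insert_of_mem (hq y hy)
          · exact Finset.mem_insert_self _ _
        · obtain ⟨q, hq⟩ := hwalk x hx
          exact ⟨q, fun y hy => Finset.mem_insert_of_mem (hq y hy)⟩
      · rw [Finset.coe_insert, Set.injOn_insert (by simpa using hbs)]
        refine ⟨hinj.congr fun x hx => (hupd x hx).symm, ?_⟩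
        rintro ⟨x, hx, hxw⟩
        rw [hupd x hx, Function.update_self] at hxw
        exact hws (Finset.mem_image.2 ⟨x, hx, hxw⟩)
      · intro x hx
        rcases Finset.mem_insert.1 hx with rfl | hx
        · rwa [Function.update_self]
        · rw [hupd x hx]
          exact hmem x hx
      · intro x hx y hy hxy
        rcases Finset.mem_insert.1 hx with rfl | hx' <;>
          rcases Finset.mem_insert.1 hy with rfl | hy'
        · exact absurd hxy (K.irrefl)
        · rw [Function.update_self, hupd y hy', huniq y hy' hxy.symm]
          exact hwa.symm
        · rw [Function.update_self, hupd x hx', huniq x hx' hxy]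
          exact hwa
        · rw [hupd x hx', hupd y hy']
          exact hadj x hx' y hy' hxy
  have hpos : 0 < Fintype.card V := Fintype.card_pos_iff.2 ⟨r⟩
  obtain ⟨s, φ, hcard, -, -, hinj, hmem, hadj⟩ := key (Fintype.card V - 1) (by omega)
  have hs : s = Finset.univ := Finset.card_eq_iff_eq_univ s |>.1 (by omega)
  subst hs
  exact ⟨φ, fun x y h => hinj (by simp) (by simp) h, fun x => hmem x (by simp),
    fun a b h => hadj a (by simp) b (by simp) h⟩

/-- Removing the low-degree members of `S` leaves a set losing few elements of any subset. -/
theorem card_filter_lt_add_of_filter_subset {α : Type*} {S N : Finset α} {c : ℝ} (P : α → Prop)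
    [DecidablePred P] (hN : N ⊆ S) (h : ((S.filter fun x => ¬ P x).card : ℝ) < c) :
    (N.card : ℝ) < (N.filter P).card + c := by
  have h₁ : (N.filter fun x => ¬ P x).card ≤ (S.filter fun x => ¬ P x).card :=
    Finset.card_le_card (Finset.filter_subset_filter _ hN)
  have h₂ := Finset.card_filter_add_card_filter_not (s := N) P
  have h₃ : ((N.filter P).card : ℝ) + (N.filter fun x => ¬ P x).card = N.card := by
    exact_mod_cast h₂
  have h₄ : ((N.filter fun x => ¬ P x).card : ℝ) ≤ (S.filter fun x => ¬ P x).card := by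
    exact_mod_cast h₁
  linarith

open Classical in
/-- Inside a dense regular pair `(u, v)`, given large sets `A ⊇ N₁, N₂` and `B`, one finds
subsets with minimum degree conditions suitable for greedy embedding. -/
theorem IsRegularPair.exists_min_degree {α : Type*} [DecidableEq α] {G : SimpleGraph α} {d ε : ℝ}
    {u v A B N₁ N₂ : Finset α} (hd1 : d ≤ 1) (hd0 : 0 < d) (hε0 : 0 < ε)
    (hεd : ε < d ^ 2 / 100) (h : IsRegularPair G ε u v) (hd : d ≤ density G u v)
    (huv : u.card = v.card) (hu : 0 < u.card) (hA : A ⊆ u) (hB : B ⊆ v)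
    (hBcard : 4 * Real.sqrt ε * (u.card : ℝ) ≤ B.card) (hN₁ : N₁ ⊆ A) (hN₂ : N₂ ⊆ A)
    (hN₁card : 3 * ε * (u.card : ℝ) ≤ N₁.card) (hN₂card : 3 * ε * (u.card : ℝ) ≤ N₂.card) :
    ∃ A' ⊆ A, ∃ B' ⊆ B, (N₁ ∩ A').Nonempty ∧
      (∀ a ∈ A', ε ^ 2 * (u.card : ℝ) ≤ ((B'.filter (G.Adj a)).card : ℝ)) ∧
      ∀ b ∈ B', ε ^ 2 * (u.card : ℝ) ≤ (((N₂ ∩ A').filter (G.Adj b)).card : ℝ) := by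
  obtain ⟨s, hs0, hsε⟩ : ∃ s, 0 < s ∧ s = Real.sqrt ε := ⟨_, Real.sqrt_pos.2 hε0, rfl⟩
  have hs2 : s ^ 2 = ε := by rw [hsε, Real.sq_sqrt hε0.le]
  rw [← hsε] at hBcard
  have hsd : 10 * s < d := by
    by_contra! hle
    nlinarith
  have hs1 : s < 1 / 10 := by linarith
  have hn : (0 : ℝ) < u.card := by exact_mod_cast hu
  have hnv : (v.card : ℝ) = u.card := by exact_mod_cast huv.symm
  set n : ℝ := (u.card : ℝ)
  have hεn : 0 < ε * n := mul_pos hε0 hn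
  have hdε : 9 * s ≤ d - ε := by nlinarith
  have hdε0 : 0 < d - ε := by linarith
  have hsn : ε * n ≤ 4 * s * n := by
    have : ε ≤ 4 * s := by nlinarith
    nlinarith
  let P : α → Prop := fun a => (d - ε) * B.card ≤ ((B.filter (G.Adj a)).card : ℝ)
  have hP : ((A.filter fun a => ¬ P a).card : ℝ) < ε * n := by
    have := h.card_filter_degree_lt hd hε0 hu (huv ▸ hu) hA hB (by rw [hnv]; linarith)
    refine lt_of_eq_of_lt ?_ this
    congr 1
    exact_mod_cast congrArg Finset.card (Finset.filter_congr fun x _ => not_le)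
  have hN₁' := card_filter_lt_add_of_filter_subset P hN₁ hP
  have hN₂' := card_filter_lt_add_of_filter_subset P hN₂ hP
  have hinter : ∀ {N : Finset α}, N ⊆ A → N ∩ A.filter P = N.filter P := by
    intro N hN
    ext x
    simp only [Finset.mem_inter, Finset.mem_filter]
    exact ⟨fun hx => ⟨hx.1, hx.2.2⟩, fun hx => ⟨hx.1, hN hx.1, hx.2⟩⟩
  let N := N₂.filter P
  have hNcard : 2 * (ε * n) ≤ N.card := by
    change _ ≤ ((N₂.filter P).card : ℝ)
    linarith
  let Q : α → Prop := fun b => (d - ε) * N.card ≤ ((N.filter (G.Adj b)).card : ℝ)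
  have hQ : ((B.filter fun b => ¬ Q b).card : ℝ) < ε * n := by
    have := h.symm.card_filter_degree_lt (density_comm G u v ▸ hd) hε0 (huv ▸ hu) hu hB
      (((Finset.filter_subset P N₂).trans hN₂).trans hA) (by change _ ≤ (N.card : ℝ); linarith)
    rw [hnv] at this
    refine lt_of_eq_of_lt ?_ this
    congr 1
    exact_mod_cast congrArg Finset.card (Finset.filter_congr fun x _ => not_le)
  refine ⟨A.filter P, Finset.filter_subset _ _, B.filter Q, Finset.filter_subset _ _, ?_, ?_, ?_⟩
  · rw [hinter hN₁, ← Finset.card_pos]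
    have : (0 : ℝ) < (N₁.filter P).card := by linarith
    exact_mod_cast this
  · intro a ha
    have h₁ : (d - ε) * B.card ≤ ((B.filter (G.Adj a)).card : ℝ) := (Finset.mem_filter.1 ha).2
    have h₂ := card_filter_lt_add_of_filter_subset Q (Finset.filter_subset (G.Adj a) B) hQ
    rw [Finset.filter_comm] at h₂
    have h₃ : 9 * s * (4 * s * n) ≤ (d - ε) * B.card :=
      mul_le_mul hdε hBcard (hεn.le.trans hsn) hdε0.le
    have h₄ : 9 * s * (4 * s * n) = 36 * (ε * n) := by rw [← hs2]; ring
    have h₅ : ε ^ 2 * n ≤ ε * n := by nlinarith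
    linarith
  · intro b hb
    rw [hinter hN₂]
    have h₁ : (d - ε) * N.card ≤ ((N.filter (G.Adj b)).card : ℝ) := (Finset.mem_filter.1 hb).2
    have h₃ : 9 * s * (2 * (ε * n)) ≤ (d - ε) * N.card :=
      mul_le_mul hdε hNcard (by linarith) hdε0.le
    have h₄ : ε ^ 2 * n ≤ 9 * s * (2 * (ε * n)) := by
      have : ε ≤ 18 * s := by nlinarith
      nlinarith
    exact h₄.trans (h₃.trans h₁)

/-- For all `0 < d, ε ≤ 1` with `ε < d²/100` and every `M ≥ 1` there is `β > 0` such that: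
given pairwise disjoint vertex sets `v₁, u, v` of a graph `G` with `(v₁,u)` and `(u,v)`
`ε`-regular of density at least `d` and `|v₁| = |u| = |v| ≥ k/M`, vertices
`vs₁, vs₂ ∈ v₁`, a tree `K` of order `j ≤ βk` with two vertices `x₁, x₂` in the same
colour class (`vs₁ ≠ vs₂` iff `x₁ ≠ x₂`), and a set `U ⊆ u ∪ v` with
`|u ∖ U| ≥ 4√ε|u|`, `|v ∖ U| ≥ 4√ε|v|` and `|N_G(vsᵢ) ∩ (u ∖ U)| ≥ 3ε|u|`, there is an
injective edge-preserving embedding `φ` of `K` into `(u ∪ v) ∖ U` with `φ(x₁) ∈ u`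
adjacent to `vs₁` and `φ(x₂) ∈ u` adjacent to `vs₂`. -/
theorem embed_small_tree (d ε : ℝ) (hd0 : 0 < d) (hd1 : d ≤ 1)
    (hε0 : 0 < ε) (hε1 : ε ≤ 1) (hεd : ε < d ^ 2 / 100) (M : ℝ) (hM : 1 ≤ M) :
    ∃ β : ℝ, 0 < β ∧
      ∀ (α : Type) [DecidableEq α] (G : SimpleGraph α) (v₁ u v : Finset α),
        Disjoint v₁ u → Disjoint u v → Disjoint v₁ v →
        IsRegularPair G ε v₁ u → IsRegularPair G ε u v →
        d ≤ density G v₁ u → d ≤ density G u v →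
      ∀ k : ℕ, v₁.card = u.card → u.card = v.card → (k : ℝ) / M ≤ (u.card : ℝ) →
      ∀ vs₁ ∈ v₁, ∀ vs₂ ∈ v₁,
      ∀ (j : ℕ) (K : SimpleGraph (Fin j)), K.IsTree → (j : ℝ) ≤ β * k →
      ∀ (x₁ x₂ : Fin j) (W₁ W₂ : Finset (Fin j)),
        (∀ z, z ∈ W₁ ∨ z ∈ W₂) → Disjoint W₁ W₂ →
        (∀ ⦃a b⦄, K.Adj a b → ((a ∈ W₁ ∧ b ∈ W₂) ∨ (a ∈ W₂ ∧ b ∈ W₁))) →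
        ((x₁ ∈ W₁ ∧ x₂ ∈ W₁) ∨ (x₁ ∈ W₂ ∧ x₂ ∈ W₂)) →
        (vs₁ ≠ vs₂ ↔ x₁ ≠ x₂) →
      ∀ U ⊆ u ∪ v,
        4 * Real.sqrt ε * (u.card : ℝ) ≤ (((u \ U).card : ℝ)) →
        4 * Real.sqrt ε * (v.card : ℝ) ≤ (((v \ U).card : ℝ)) →
        3 * ε * (u.card : ℝ) ≤ ({w | w ∈ u \ U ∧ G.Adj vs₁ w}.ncard : ℝ) →
        3 * ε * (u.card : ℝ) ≤ ({w | w ∈ u \ U ∧ G.Adj vs₂ w}.ncard : ℝ) →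
        ∃ φ : Fin j → α,
          Function.Injective φ ∧
          (∀ x, φ x ∈ (u ∪ v) \ U) ∧
          (∀ ⦃a b⦄, K.Adj a b → G.Adj (φ a) (φ b)) ∧
          φ x₁ ∈ u ∧ G.Adj (φ x₁) vs₁ ∧ φ x₂ ∈ u ∧ G.Adj (φ x₂) vs₂ := by
  classical
  have hM0 : 0 < M := by linarith
  refine ⟨ε ^ 2 / M, by positivity, ?_⟩
  intro α _ G v₁ u v _ huv _ _ hreg _ hd k _ hcard hk vs₁ _ vs₂ _ j K hK hj x₁ x₂ W₁ W₂
    hcov hdisj hbip hx hvs U _ _ hvU hN₁ hN₂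
  have hjn : (j : ℝ) ≤ ε ^ 2 * u.card := by
    calc (j : ℝ) ≤ ε ^ 2 / M * k := hj
      _ = ε ^ 2 * (k / M) := by ring
      _ ≤ ε ^ 2 * u.card := by gcongr
  have hj0 : (0 : ℝ) < j := by exact_mod_cast x₁.pos
  have hu : 0 < u.card := by
    have : (0 : ℝ) < u.card := by
      by_contra! hle
      nlinarith [sq_nonneg ε]
    exact_mod_cast this
  have hset : ∀ w, {z | z ∈ u \ U ∧ G.Adj w z}.ncard = ((u \ U).filter (G.Adj w)).card := by
    intro w
    rw [← Set.ncard_coe_finset]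
    congr 1
    ext z
    simp
  rw [hset] at hN₁ hN₂
  rw [← hcard] at hvU
  obtain ⟨A, hA, B, hB, ⟨w₀, hw₀⟩, hAB, hBA⟩ := hreg.exists_min_degree hd1 hd0 hε0 hεd hd hcard hu
    (Finset.sdiff_subset (t := U)) (Finset.sdiff_subset (t := U)) hvU
    (Finset.filter_subset (G.Adj vs₁) _) (Finset.filter_subset (G.Adj vs₂) _) hN₁ hN₂
  obtain ⟨W, hx₁, hx₂, hW⟩ : ∃ W : Finset (Fin j), x₁ ∈ W ∧ x₂ ∈ W ∧
      ∀ ⦃a b⦄, K.Adj a b → (a ∈ W ↔ b ∉ W) := by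
    have hdis : ∀ z, z ∈ W₁ → z ∉ W₂ := fun z h₁ h₂ => Finset.disjoint_left.1 hdisj h₁ h₂
    rcases hx with hx | hx
    · exact ⟨W₁, hx.1, hx.2, fun a b h => by grind⟩
    · exact ⟨W₂, hx.1, hx.2, fun a b h => by grind⟩
  let T : Fin j → Finset α := fun x =>
    if x = x₁ then (u \ U).filter (G.Adj vs₁) ∩ A
    else if x = x₂ then (u \ U).filter (G.Adj vs₂) ∩ A
    else if x ∈ W then A else B
  have hTW : ∀ x ∈ W, T x ⊆ A := by
    intro x hx
    simp only [T, if_pos hx]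
    split_ifs
    exacts [Finset.inter_subset_right, Finset.inter_subset_right, Finset.Subset.rfl]
  have hTW' : ∀ x ∉ W, T x = B := by
    intro x hx
    simp only [T, if_neg hx, if_neg (fun h => hx (h ▸ hx₁) : x ≠ x₁),
      if_neg (fun h => hx (h ▸ hx₂) : x ≠ x₂)]
  have hTW₂ : ∀ x ∈ W, x ≠ x₁ → (u \ U).filter (G.Adj vs₂) ∩ A ⊆ T x := by
    intro x hx hne
    simp only [T, if_pos hx, if_neg hne]
    split_ifs
    exacts [Finset.Subset.rfl, Finset.inter_subset_right]
  obtain ⟨φ, hinj, hφT, hφ⟩ := hK.exists_greedy_embedding_s11 G x₁ T ⟨w₀, by simpa [T] using hw₀⟩ (by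
    intro a b hab hb w hw
    rw [Fintype.card_fin]
    by_cases ha : a ∈ W
    · rw [hTW' b ((hW hab).1 ha)]
      exact_mod_cast hjn.trans (hAB w (hTW a ha hw))
    · have hbW : b ∈ W := (hW hab.symm).2 ha
      rw [hTW' a ha] at hw
      have h₁ : (j : ℝ) ≤ _ := hjn.trans (hBA w hw)
      have h₂ := Finset.card_le_card (Finset.filter_subset_filter (G.Adj w) (hTW₂ b hbW hb))
      exact (Nat.cast_le.1 h₁).trans h₂)
  have h₁ : φ x₁ ∈ (u \ U).filter (G.Adj vs₁) := by
    have := hφT x₁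
    simp only [T, if_true] at this
    exact (Finset.mem_inter.1 this).1
  have h₂ : φ x₂ ∈ (u \ U).filter (G.Adj vs₂) := by
    by_cases h : x₂ = x₁
    · have hv : vs₁ = vs₂ := by
        by_contra hne
        exact hvs.1 hne h.symm
      rwa [h, ← hv]
    · have := hφT x₂
      simp only [T, if_neg h, if_true] at this
      exact (Finset.mem_inter.1 this).1
  rw [Finset.mem_filter, Finset.mem_sdiff] at h₁ h₂
  refine ⟨φ, hinj, fun x => ?_, hφ, h₁.1.1, h₁.2.symm, h₂.1.1, h₂.2.symm⟩
  by_cases hxW : x ∈ W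
  · have := Finset.mem_sdiff.1 (hA (hTW x hxW (hφT x)))
    exact Finset.mem_sdiff.2 ⟨Finset.mem_union_left _ this.1, this.2⟩
  · have := Finset.mem_sdiff.1 (hB (hTW' x hxW ▸ hφT x))
    exact Finset.mem_sdiff.2 ⟨Finset.mem_union_right _ this.1, this.2⟩
end

section
/- Let 0 < ε ≤ 1, and let v₁, v₂, …, v_m be pairwise disjoint nonempty vertex sets in a graph G such that the pair (v₁, vᵢ) is ε-regular for every i ∈ {2, …, m}. Call a vertex x ∈ v₁ atypical to vᵢ if deg(x, vᵢ) < (d(v₁, vᵢ) − ε)|vᵢ|. Then at most √ε·|v₁| vertices of v₁ are atypical to more than √ε·m of the sets v₂, …, v_m. -/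
open SimpleGraph Finset

open Classical in
/-- The edges between `X` and `Y` are counted by the degrees into `Y` of the vertices of `X`. -/
theorem eBetween_eq_sum_ncard {V : Type*} (G : SimpleGraph V) (X Y : Finset V) :
    eBetween G X Y = ∑ x ∈ X, {y | y ∈ Y ∧ G.Adj x y}.ncard := by
  have hset : {p : V × V | p.1 ∈ X ∧ p.2 ∈ Y ∧ G.Adj p.1 p.2} =
      ↑((X ×ˢ Y).filter fun p => G.Adj p.1 p.2) := by
    ext p
    simp [and_assoc]
  have hdeg (x : V) : {y | y ∈ Y ∧ G.Adj x y}.ncard = (Y.filter fun y => G.Adj x y).card := by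
    rw [← Set.ncard_coe_finset, Finset.coe_filter]
  rw [eBetween, hset, Set.ncard_coe_finset]
  simp only [hdeg, Finset.card_filter, Finset.sum_product]

/-- In an `ε`-regular pair `(X, Y)`, a set of vertices of `X` whose degrees into `Y` are all
below `(d(X, Y) - ε)|Y|` has fewer than `ε|X|` elements. -/
theorem IsRegularPair.card_lt_of_forall_degree_lt {V : Type*} {G : SimpleGraph V} {ε : ℝ}
    {X Y A : Finset V} (h : IsRegularPair G ε X Y) (hε0 : 0 < ε) (hε1 : ε ≤ 1)
    (hX : X.Nonempty) (hY : Y.Nonempty) (hAX : A ⊆ X)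
    (hA : ∀ x ∈ A, ({y | y ∈ Y ∧ G.Adj x y}.ncard : ℝ) < (density G X Y - ε) * (Y.card : ℝ)) :
    (A.card : ℝ) < ε * (X.card : ℝ) := by
  by_contra! hcard
  have hXpos : (0 : ℝ) < X.card := by exact_mod_cast hX.card_pos
  have hYpos : (0 : ℝ) < Y.card := by exact_mod_cast hY.card_pos
  have hApos : (0 : ℝ) < A.card := (mul_pos hε0 hXpos).trans_le hcard
  have hAne : A.Nonempty := Finset.card_pos.mp (by exact_mod_cast hApos)
  have hreg := h A hAX Y subset_rfl hcard (mul_le_of_le_one_left hYpos.le hε1)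
  have hsum : (eBetween G A Y : ℝ) < A.card * ((density G X Y - ε) * Y.card) := by
    rw [eBetween_eq_sum_ncard, Nat.cast_sum, ← nsmul_eq_mul, ← Finset.sum_const]
    exact Finset.sum_lt_sum_of_nonempty hAne hA
  have hdens : density G A Y < density G X Y - ε := by
    rw [density, div_lt_iff₀ (mul_pos hApos hYpos)]
    linarith
  linarith [(abs_le.mp hreg).1]

open Classical in
/-- If each of the sets `{x ∈ X | P x i}` has at most `c` elements, then the number of `x ∈ X`
satisfying `P x i` for more than `t` indices `i`, multiplied by `t`, is at most `c` times the
number of indices. -/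
theorem card_filter_lt_mul_le {α ι : Type*} [Fintype ι] (X : Finset α) (P : α → ι → Prop)
    (c t : ℝ) (hc : ∀ i, ((X.filter fun x => P x i).card : ℝ) ≤ c) :
    ((X.filter fun x => t < ((Finset.univ.filter (P x)).card : ℝ)).card : ℝ) * t ≤
      Fintype.card ι * c := by
  set B := X.filter fun x => t < ((Finset.univ.filter (P x)).card : ℝ)
  calc (B.card : ℝ) * t = ∑ _x ∈ B, t := by simp
    _ ≤ ∑ x ∈ B, ((Finset.univ.filter (P x)).card : ℝ) :=
        Finset.sum_le_sum fun x hx => (Finset.mem_filter.mp hx).2.le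
    _ ≤ ∑ x ∈ X, ((Finset.univ.filter (P x)).card : ℝ) :=
        Finset.sum_le_sum_of_subset_of_nonneg (Finset.filter_subset _ _)
          fun _ _ _ => Nat.cast_nonneg _
    _ = ∑ i : ι, ((X.filter fun x => P x i).card : ℝ) := by
        simp only [Finset.card_filter, Nat.cast_sum]
        exact Finset.sum_comm
    _ ≤ ∑ _i : ι, c := Finset.sum_le_sum fun i _ => hc i
    _ = Fintype.card ι * c := by simp

/-- Let `0 < ε ≤ 1` and let `X = v₁` together with `Y 0, …, Y (N-1)` (the sets
`v₂, …, v_m`, so that `m = N + 1`) be pairwise disjoint nonempty vertex sets such that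
each pair `(X, Y i)` is `ε`-regular. Then at most `√ε·|X|` vertices of `X` are atypical
(i.e. satisfy `deg(x, Y i) < (d(X, Y i) − ε)|Y i|`) to more than `√ε·m` of the sets
`Y 0, …, Y (N-1)`. -/
theorem atypical_to_many_clusters_le {V : Type*} (G : SimpleGraph V) (ε : ℝ)
    (hε0 : 0 < ε) (hε1 : ε ≤ 1) (N : ℕ) (X : Finset V) (Y : Fin N → Finset V)
    (hXne : X.Nonempty) (hYne : ∀ i, (Y i).Nonempty)
    (hdXY : ∀ i, Disjoint X (Y i))
    (hdYY : ∀ i j, i ≠ j → Disjoint (Y i) (Y j))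
    (hreg : ∀ i, IsRegularPair G ε X (Y i)) :
    ({x | x ∈ X ∧
        Real.sqrt ε * ((N : ℝ) + 1) <
          ({i : Fin N | ({y | y ∈ Y i ∧ G.Adj x y}.ncard : ℝ)
              < (density G X (Y i) - ε) * ((Y i).card : ℝ)}.ncard : ℝ)}.ncard : ℝ)
      ≤ Real.sqrt ε * (X.card : ℝ) := by
  classical
  let P : V → Fin N → Prop := fun x i =>
    ({y | y ∈ Y i ∧ G.Adj x y}.ncard : ℝ) < (density G X (Y i) - ε) * ((Y i).card : ℝ)
  have hP (x : V) : {i | P x i}.ncard = (Finset.univ.filter (P x)).card := by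
    rw [← Set.ncard_coe_finset, Finset.coe_filter_univ]
  change ({x | x ∈ X ∧ √ε * ((N : ℝ) + 1) < ({i | P x i}.ncard : ℝ)}.ncard : ℝ) ≤ √ε * X.card
  simp only [hP]
  rw [← Finset.coe_filter, Set.ncard_coe_finset]
  have hcount := card_filter_lt_mul_le X P (ε * X.card) (√ε * ((N : ℝ) + 1)) fun i =>
    ((hreg i).card_lt_of_forall_degree_lt hε0 hε1 hXne (hYne i) (Finset.filter_subset _ _)
      fun x hx => (Finset.mem_filter.mp hx).2).le
  rw [Fintype.card_fin] at hcount
  have hpos : 0 < √ε * ((N : ℝ) + 1) := mul_pos (Real.sqrt_pos.mpr hε0) (by positivity)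
  refine le_of_mul_le_mul_right (hcount.trans ?_) hpos
  calc (N : ℝ) * (ε * X.card) ≤ (N + 1) * (ε * X.card) := by gcongr; linarith
    _ = (N + 1) * (√ε * √ε * X.card) := by rw [Real.mul_self_sqrt hε0.le]
    _ = √ε * X.card * (√ε * (N + 1)) := by ring
end

section
/- Every graph G with at least one edge contains a nonempty induced subgraph G' with average degree d̄(G') ≥ d̄(G) and minimum degree δ(G') > d̄(G)/2. -/
open SimpleGraph Finset

/-- The degree of a vertex `v` in a graph `G` (number of neighbours). -/
noncomputable def degree' {V : Type*} (G : SimpleGraph V) (v : V) : ℕ :=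
  (G.neighborSet v).ncard

/-- The average degree of a finite graph `G`, i.e. `2|E(G)|/|V(G)|`. -/
noncomputable def avgDeg {V : Type*} [Fintype V] (G : SimpleGraph V) : ℝ :=
  (∑ v, (degree' G v : ℝ)) / (Fintype.card V)

open Classical in
theorem degree'_induce {V : Type*} (G : SimpleGraph V) (S : Finset V) (v : (S : Set V)) :
    degree' (G.induce (S : Set V)) v = #{w ∈ S | G.Adj v w} := by
  rw [degree', ← Set.ncard_image_of_injective _ Subtype.val_injective, ← Set.ncard_coe_finset]
  congr 1
  ext w
  simp [and_comm]

open Classical in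
theorem avgDeg_induce {V : Type*} (G : SimpleGraph V) (S : Finset V)
    [Fintype (S : Set V)] :
    avgDeg (G.induce (S : Set V)) = (∑ v ∈ S, (#{w ∈ S | G.Adj v w} : ℝ)) / #S := by
  simp only [avgDeg, degree'_induce]
  congr 1
  · exact (Finset.sum_subtype S (fun _ => Finset.mem_coe.symm)
      (fun v => (#{w ∈ S | G.Adj v w} : ℝ))).symm
  · rw [← Nat.card_eq_fintype_card, Nat.card_coe_set_eq, Set.ncard_coe_finset]

open Classical in
theorem avgDeg_eq_sum_card_filter {V : Type*} [Fintype V] (G : SimpleGraph V) :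
    avgDeg G = (∑ v, (#{w | G.Adj v w} : ℝ)) / Fintype.card V := by
  simp only [avgDeg, degree', ← Set.ncard_coe_finset]
  simp [SimpleGraph.neighborSet]

open Classical in
theorem avgDeg_pos {V : Type*} [Fintype V] (G : SimpleGraph V) (hE : ∃ x y, G.Adj x y) :
    0 < avgDeg G := by
  obtain ⟨x, y, hxy⟩ := hE
  have : Nonempty V := ⟨x⟩
  rw [avgDeg_eq_sum_card_filter]
  refine div_pos (Finset.sum_pos' (fun _ _ => by positivity) ⟨x, Finset.mem_univ x, ?_⟩)
    (by exact_mod_cast Fintype.card_pos)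
  exact_mod_cast Finset.card_pos.mpr ⟨y, by simpa using hxy⟩

/-- Adding a vertex `v` raises the degree sum by twice the degree of `v`. -/
theorem sum_card_filter_adj_insert {V : Type*} [DecidableEq V] (G : SimpleGraph V)
    [DecidableRel G.Adj] {T : Finset V} {v : V}
    (hv : v ∉ T) :
    ∑ u ∈ insert v T, #{w ∈ insert v T | G.Adj u w} =
      ∑ u ∈ T, #{w ∈ T | G.Adj u w} + 2 * #{w ∈ insert v T | G.Adj v w} := by
  simp only [Finset.card_filter, Finset.sum_insert hv, Finset.sum_add_distrib, G.irrefl,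
    if_false, G.adj_comm _ v]
  ring

/-- Every graph `G` with at least one edge contains a nonempty induced subgraph `G'` with
average degree `d̄(G') ≥ d̄(G)` and minimum degree `δ(G') > d̄(G)/2`. -/
theorem exists_induced_subgraph_avgDeg_minDeg {V : Type*} [Fintype V] [DecidableEq V]
    (G : SimpleGraph V) (hE : ∃ x y, G.Adj x y) :
    ∃ S : Finset V, S.Nonempty ∧
      avgDeg G ≤ avgDeg (G.induce (S : Set V)) ∧
      ∀ v : (S : Set V), avgDeg G / 2 < (degree' (G.induce (S : Set V)) v : ℝ) := by
  classical
  have hd := avgDeg_pos G hE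
  have : Nonempty V := ⟨hE.choose⟩
  let P : Finset V → Prop := fun S =>
    S.Nonempty ∧ avgDeg G * #S ≤ ((∑ v ∈ S, #{w ∈ S | G.Adj v w} : ℕ) : ℝ)
  have huniv : P Finset.univ := by
    refine ⟨Finset.univ_nonempty, ?_⟩
    have hc : (Fintype.card V : ℝ) ≠ 0 := by exact_mod_cast Fintype.card_ne_zero
    rw [avgDeg_eq_sum_card_filter, Finset.card_univ, div_mul_cancel₀ _ hc]
    push_cast
    exact le_of_eq (Finset.sum_congr rfl fun _ _ => by congr)
  obtain ⟨S, ⟨hne, hS⟩, hmin⟩ :=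
    (Set.toFinite {S | P S}).exists_minimal ⟨_, huniv⟩
  refine ⟨S, hne, ?_, ?_⟩
  · rw [avgDeg_induce, le_div_iff₀ (by exact_mod_cast hne.card_pos)]
    push_cast at hS
    convert hS
  · rintro ⟨v, hv⟩
    have hv : v ∈ S := hv
    rw [degree'_induce]
    by_contra! hle
    have hrec := sum_card_filter_adj_insert G (Finset.notMem_erase v S)
    have hcard := Finset.card_erase_add_one hv
    have hins : insert v (S.erase v) = S := Finset.insert_erase hv
    rw [hins] at hrec
    rw [hrec, ← hcard] at hS
    push_cast at hS
    rcases (S.erase v).eq_empty_or_nonempty with h0 | h1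
    · obtain rfl : S = {v} := by rw [← hins, h0]; rfl
      simp [Finset.filter_singleton] at hS
      linarith
    · have hT : P (S.erase v) := by
        refine ⟨h1, ?_⟩
        push_cast
        linarith
      exact Finset.notMem_erase v S (hmin hT (Finset.erase_subset v S) hv)
end
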